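/- Let C, D ⊂ ℝ^d be polyhedral convex cones. Then the set {ϑ ∈ SO(d) : C ∩ ϑD = {o} or C ⋔ ϑD} has ν-measure one. If, in addition, C and D are not both linear subspaces, then the set {ϑ ∈ SO(d) : C ∩ ϑD = {o} or C ∩ ϑD is not a linear subspace} has ν-measure one. -/

import Mathlib

open MeasureTheory Set
open scoped ENNReal RealInnerProductSpace Pointwise

noncomputable section

/-- Abbreviation for Euclidean space `ℝ^d`. -/
abbrev Euc (d : ℕ) := EuclideanSpace ℝ (Fin d)

/-- The rotation group `SO(d)`, as a subgroup of the orthogonal group. -/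
def SOG (d : ℕ) : Subgroup (Matrix.orthogonalGroup (Fin d) ℝ) where
  carrier := {A | (A : Matrix (Fin d) (Fin d) ℝ).det = 1}
  one_mem' := Matrix.det_one
  mul_mem' := by
    intro a b ha hb
    simp only [Set.mem_setOf_eq] at *
    rw [show ((a * b : Matrix.orthogonalGroup (Fin d) ℝ) : Matrix (Fin d) (Fin d) ℝ)
        = (a : Matrix (Fin d) (Fin d) ℝ) * (b : Matrix (Fin d) (Fin d) ℝ) from rfl,
      Matrix.det_mul, ha, hb, mul_one]
  inv_mem' := by
    intro a ha
    simp only [Set.mem_setOf_eq] at *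
    rw [show ((a⁻¹ : Matrix.orthogonalGroup (Fin d) ℝ) : Matrix (Fin d) (Fin d) ℝ)
        = star (a : Matrix (Fin d) (Fin d) ℝ) from rfl]
    rw [Matrix.star_eq_conjTranspose, Matrix.det_conjTranspose, ha, star_one]

instance (d : ℕ) : MeasurableSpace (SOG d) := borel _

/-- A rotation `ϑ ∈ SO(d)`, as a linear map on `ℝ^d`. -/
def rotLin {d : ℕ} (ϑ : SOG d) : Euc d →ₗ[ℝ] Euc d :=
  ((EuclideanSpace.equiv (Fin d) ℝ).symm.toLinearEquiv.toLinearMap.comp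
    (Matrix.mulVecLin (ϑ : Matrix (Fin d) (Fin d) ℝ))).comp
    (EuclideanSpace.equiv (Fin d) ℝ).toLinearEquiv.toLinearMap

/-- The action of a rotation `ϑ ∈ SO(d)` on `ℝ^d`. -/
def rot {d : ℕ} (ϑ : SOG d) : Euc d → Euc d := rotLin ϑ

variable {d : ℕ}

/-- The standard Gaussian probability measure `γ_d` on `ℝ^d`. -/
def stdGauss (d : ℕ) : Measure (Euc d) :=
  volume.withDensity fun x =>
    ENNReal.ofReal ((2 * Real.pi) ^ (-(d : ℝ) / 2) * Real.exp (-‖x‖ ^ 2 / 2))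

/-- The standard Gaussian measure `γ_L` of a linear subspace `L` of `ℝ^d`, viewed as a measure
on `ℝ^d` concentrated on `L`. -/
def gauss (L : Submodule ℝ (Euc d)) : Measure (Euc d) :=
  Measure.map (Subtype.val) <|
    (volume : Measure L).withDensity fun x =>
      ENNReal.ofReal ((2 * Real.pi) ^ (-(Module.finrank ℝ L : ℝ) / 2) *
        Real.exp (-‖(x : Euc d)‖ ^ 2 / 2))

/-- A set is conic if it is stable under multiplication by positive scalars. -/
def IsConic (A : Set (Euc d)) : Prop := ∀ a ∈ A, ∀ r : ℝ, 0 < r → r • a ∈ A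

/-- A polyhedral (convex) cone: an intersection of finitely many closed halfspaces bounded by
linear hyperplanes (the empty intersection being all of `ℝ^d`). -/
def IsPolyCone (C : Set (Euc d)) : Prop :=
  ∃ U : Finset (Euc d), C = ⋂ u ∈ U, {x | ⟪u, x⟫ ≤ 0}

/-- `F` is a face of the convex set `C`: a nonempty convex extreme subset. -/
def IsFace (C F : Set (Euc d)) : Prop := IsExtreme ℝ C F ∧ Convex ℝ F ∧ F.Nonempty

/-- The linear hull `L(F)` of a set `F`. -/
def linHull (F : Set (Euc d)) : Submodule ℝ (Euc d) := Submodule.span ℝ F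

/-- The dimension of a face (or cone) `F`, i.e. the dimension of its linear hull. -/
def dimS (F : Set (Euc d)) : ℕ := Module.finrank ℝ (linHull F)

/-- `F` is a `k`-dimensional face of `C`. -/
def IsFaceDim (C F : Set (Euc d)) (k : ℕ) : Prop := IsFace C F ∧ dimS F = k

/-- The normal cone `N(C,F)` of the cone `C` at its face `F`. -/
def normalCone (C F : Set (Euc d)) : Set (Euc d) :=
  {u | (∀ y ∈ C, ⟪u, y⟫ ≤ 0) ∧ ∀ x ∈ F, ⟪u, x⟫ = 0}

/-- The conic curvature measure `Φ_k(C, A)` of a polyhedral cone `C`, evaluated at `A`: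
`Φ_k(C,A) = ∑_{F ∈ 𝓕_k(C)} γ_{L(F)}(F ∩ A) ⬝ γ_{L(F)^⊥}(N(C,F))`. -/
def Phi (k : ℕ) (C A : Set (Euc d)) : ℝ≥0∞ :=
  ∑' F : {F : Set (Euc d) // IsFaceDim C F k},
    gauss (linHull F.1) (F.1 ∩ A) * gauss (linHull F.1)ᗮ (normalCone C F.1)

/-- The conic intrinsic volume `V_k(C) = ∑_{F ∈ 𝓕_k(C)} γ_d(F + N(C,F))`. -/
def cV (k : ℕ) (C : Set (Euc d)) : ℝ≥0∞ :=
  ∑' F : {F : Set (Euc d) // IsFaceDim C F k},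
    stdGauss d (F.1 + normalCone C F.1)

/-- The localization `φ_F(C,A) = γ_d((A ∩ F) + N(C,F))` of `v_F(C)`. -/
def phiLoc (C F A : Set (Euc d)) : ℝ≥0∞ := stdGauss d ((A ∩ F) + normalCone C F)

/-- `C` is (the underlying set of) a linear subspace of `ℝ^d`. -/
def IsLinSubspace (C : Set (Euc d)) : Prop := ∃ L : Submodule ℝ (Euc d), (L : Set (Euc d)) = C

/-- Two polyhedral cones intersect transversely: `dim (F ∩ G) = dim F + dim G − d` and the
relative interiors meet. -/
def Transverse (F G : Set (Euc d)) : Prop :=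
  (dimS (F ∩ G) : ℤ) = (dimS F : ℤ) + (dimS G : ℤ) - d ∧
    (intrinsicInterior ℝ F ∩ intrinsicInterior ℝ G).Nonempty

/-- The volume of the parallelepiped spanned by the union of orthonormal bases of `L₁` and `L₂`
(the square root of the Gram determinant of the combined family). -/
def gramVol (L₁ L₂ : Submodule ℝ (Euc d)) : ℝ :=
  Real.sqrt (Matrix.det (Matrix.of fun i j :
      Fin (Module.finrank ℝ L₁) ⊕ Fin (Module.finrank ℝ L₂) =>
    ⟪Sum.elim (fun a => ((stdOrthonormalBasis ℝ L₁) a : Euc d))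
        (fun b => ((stdOrthonormalBasis ℝ L₂) b : Euc d)) i,
      Sum.elim (fun a => ((stdOrthonormalBasis ℝ L₁) a : Euc d))
        (fun b => ((stdOrthonormalBasis ℝ L₂) b : Euc d)) j⟫))

/-- The generalized sine function `[L₁, L₂]` of two subspaces. -/
def genSine (L₁ L₂ : Submodule ℝ (Euc d)) : ℝ :=
  if Module.finrank ℝ L₁ + Module.finrank ℝ L₂ ≤ d then gramVol L₁ L₂ else gramVol L₁ᗮ L₂ᗮ

/-- The generalized sine function `[C, D] = [L(C), L(D)]` of two cones. -/
def genSineC (C D : Set (Euc d)) : ℝ := genSine (linHull C) (linHull D)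

/-- Spherical Lebesgue measure `σ_{d-1}` on the unit sphere of `ℝ^d`. -/
def sphLebesgue (d : ℕ) : Measure (Metric.sphere (0 : Euc d) 1) :=
  (volume : Measure (Euc d)).toSphere

/-- The normalized spherical Lebesgue measure `σ = σ_{d-1}/ω_d` on the unit sphere. -/
def sphNormalized (d : ℕ) : Measure (Metric.sphere (0 : Euc d) 1) :=
  (sphLebesgue d Set.univ)⁻¹ • sphLebesgue d

/-- The Schläfli cones induced by the hyperplanes `(u i)^⊥`, `i = 1, …, n`: the closures of the
connected components of the complement of the union of the hyperplanes. -/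
def schlafliCones {n : ℕ} (u : Fin n → Euc d) : Set (Set (Euc d)) :=
  {C | ∃ x : Euc d, (∀ i, ⟪u i, x⟫ ≠ 0) ∧
    C = closure (connectedComponentIn {y : Euc d | ∀ i, ⟪u i, y⟫ ≠ 0} x)}

/-- `C(n,d) = 2 ∑_{r=0}^{d-1} binom(n-1, r)`, the number of Schläfli cones induced by `n`
hyperplanes in general position. -/
def schlafliCount (n d : ℕ) : ℕ := 2 * ∑ r ∈ Finset.range d, (n - 1).choose r

/-- The joint distribution `σ^n` of the unit normal vectors of `n` independent isotropic random
hyperplanes. -/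
def sphPi (d n : ℕ) : Measure (Fin n → Metric.sphere (0 : Euc d) 1) :=
  Measure.pi fun _ => sphNormalized d

end

section

variable {d : ℕ}

open Filter Topology Module Submodule

theorem rotLin_one : rotLin (1 : SOG d) = LinearMap.id := by
  ext x i
  simp [rotLin]

theorem rotLin_mul (g h : SOG d) : rotLin (g * h) = rotLin g ∘ₗ rotLin h := by
  ext x i
  simp only [rotLin, LinearMap.comp_apply, Matrix.mulVecLin_apply]
  exact congrFun (Matrix.mulVec_mulVec (x : Fin d → ℝ) g.1.1 h.1.1).symm i

theorem rotLin_inv_apply (g : SOG d) (x : Euc d) : rotLin g⁻¹ (rotLin g x) = x := by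
  rw [← LinearMap.comp_apply, ← rotLin_mul, inv_mul_cancel, rotLin_one, LinearMap.id_apply]

theorem rotLin_apply_inv (g : SOG d) (x : Euc d) : rotLin g (rotLin g⁻¹ x) = x := by
  simpa using rotLin_inv_apply g⁻¹ x

theorem continuous_rotLin : Continuous fun p : SOG d × Euc d => rotLin p.1 p.2 := by
  unfold rotLin
  simp only [LinearMap.comp_apply]
  refine (EuclideanSpace.equiv (Fin d) ℝ).symm.continuous.comp ?_
  refine Continuous.matrix_mulVec
    (continuous_subtype_val.comp (continuous_subtype_val.comp continuous_fst))
    ((EuclideanSpace.equiv (Fin d) ℝ).continuous.comp continuous_snd)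

/-- An orientation preserving linear isometry comes from an element of `SO(d)`. -/
theorem exists_rotLin_eq (f : Euc d ≃ₗᵢ[ℝ] Euc d)
    (hf : LinearMap.det f.toLinearEquiv.toLinearMap = 1) : ∃ h : SOG d, ∀ x, rotLin h x = f x := by
  let b := EuclideanSpace.basisFun (Fin d) ℝ
  refine ⟨⟨⟨_, f.toMatrix_mem_unitaryGroup b b⟩, ?_⟩, fun x => ?_⟩
  · change Matrix.det _ = 1
    rw [← hf, ← LinearMap.det_toMatrix b.toBasis]
  · have := LinearMap.toMatrix_mulVec_repr b.toBasis b.toBasis f.toLinearEquiv.toLinearMap x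
    ext i
    exact congrFun this i

/-- Within the orthogonal complement of `L`, rotations fixing `L` act transitively on lines. -/
theorem exists_rotLin_fix (L : Submodule ℝ (Euc d)) {v e : Euc d} (hv : v ∈ Lᗮ) (he : e ∈ Lᗮ)
    (he0 : e ≠ 0) :
    ∃ h : SOG d, (∀ x ∈ L, rotLin h x = x) ∧ v ∈ span ℝ {rotLin h e} := by
  by_cases hv0 : v = 0
  · exact ⟨1, fun x _ => by simp [rotLin_one], by simp [hv0]⟩
  have hv0' : ‖v‖ ≠ 0 := norm_ne_zero_iff.2 hv0
  have he0' : ‖e‖ ≠ 0 := norm_ne_zero_iff.2 he0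
  set w : Euc d := (‖e‖ / ‖v‖) • v with hw
  have hwL : w ∈ Lᗮ := Lᗮ.smul_mem _ hv
  have hvw : v = (‖v‖ / ‖e‖) • w := by
    rw [hw, smul_smul, div_mul_div_cancel₀ he0', div_self hv0', one_smul]
  have hnorm : ‖e‖ = ‖w‖ := by
    rw [hw, norm_smul, norm_div, norm_norm, norm_norm, div_mul_cancel₀ _ hv0']
  by_cases hew : e = w
  · refine ⟨1, fun x _ => by simp [rotLin_one], ?_⟩
    rw [rotLin_one, LinearMap.id_apply, hew]
    exact mem_span_singleton.2 ⟨_, hvw.symm⟩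
  have hw0 : w ≠ 0 := by
    rw [← norm_ne_zero_iff, ← hnorm]; exact he0'
  have hdet : ∀ u : Euc d, u ≠ 0 →
      LinearMap.det ((ℝ ∙ u)ᗮ.reflection.toLinearEquiv.toLinearMap) = -1 := by
    intro u hu
    have := (ℝ ∙ u)ᗮ.det_reflection
    rw [orthogonal_orthogonal, finrank_span_singleton hu, pow_one] at this
    exact this
  have hfix : ∀ u ∈ Lᗮ, ∀ x ∈ L, (ℝ ∙ u)ᗮ.reflection x = x := by
    intro u hu x hx
    refine reflection_mem_subspace_eq_self (mem_orthogonal_singleton_iff_inner_right.2 ?_)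
    exact inner_left_of_mem_orthogonal hx hu
  obtain ⟨h, hh⟩ := exists_rotLin_eq
    ((ℝ ∙ (e - w))ᗮ.reflection.trans (ℝ ∙ w)ᗮ.reflection) (by
      have := LinearMap.det_comp ((ℝ ∙ w)ᗮ.reflection.toLinearEquiv.toLinearMap)
        ((ℝ ∙ (e - w))ᗮ.reflection.toLinearEquiv.toLinearMap)
      rw [hdet _ hw0, hdet _ (sub_ne_zero.2 hew)] at this
      simpa using this)
  refine ⟨h, fun x hx => ?_, ?_⟩
  · rw [hh, LinearIsometryEquiv.trans_apply, hfix _ (Lᗮ.sub_mem he hwL) x hx, hfix _ hwL x hx]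
  · rw [hh, LinearIsometryEquiv.trans_apply, reflection_sub hnorm,
      reflection_orthogonalComplement_singleton_eq_neg]
    refine mem_span_singleton.2 ⟨-(‖v‖ / ‖e‖), ?_⟩
    rw [smul_neg, neg_smul, neg_neg, ← hvw]

/-- A finite-dimensional real vector space contains a sequence (points on a moment curve) that
visits every proper subspace only finitely often. -/
theorem exists_seq_finite_mem_submodule (V : Type*) [AddCommGroup V] [Module ℝ V]
    [FiniteDimensional ℝ V] :
    ∃ v : ℕ → V, ∀ W : Submodule ℝ V, W ≠ ⊤ → {j | v j ∈ W}.Finite := by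
  let b := finBasis ℝ V
  refine ⟨fun j => ∑ i : Fin (finrank ℝ V), (j : ℝ) ^ (i : ℕ) • b i, fun W hW => ?_⟩
  obtain ⟨f, hf0, hf⟩ := W.exists_le_ker_of_lt_top (lt_top_iff_ne_top.2 hW)
  let p : Polynomial ℝ := ∑ i : Fin (finrank ℝ V), Polynomial.monomial (i : ℕ) (f (b i))
  have hcoeff : ∀ i : Fin _, p.coeff (i : ℕ) = f (b i) := by
    intro i
    simp [p, Polynomial.coeff_monomial, Fin.val_inj]
  have hp : p ≠ 0 := by
    intro hp
    refine hf0 (b.ext fun i => ?_)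
    rw [← hcoeff, hp, Polynomial.coeff_zero, LinearMap.zero_apply]
  refine ((Polynomial.finite_setOfPred_isRoot hp).preimage
    (Nat.cast_injective (R := ℝ)).injOn).subset fun j hj => ?_
  have : f (∑ i : Fin (finrank ℝ V), (j : ℝ) ^ (i : ℕ) • b i) = 0 := hf hj
  simpa [p, Polynomial.IsRoot.def, Polynomial.eval_finsetSum, mul_comm] using this

/-- If infinitely many events have the same probability `c`, then infinitely many of them occur
with probability at least `c`. -/
theorem le_measure_frequently {α : Type*} [MeasurableSpace α] (μ : Measure α) [IsFiniteMeasure μ]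
    {s : ℕ → Set α} (hs : ∀ j, MeasurableSet (s j)) {c : ℝ≥0∞} (hc : ∀ j, c ≤ μ (s j)) :
    c ≤ μ {x | ∃ᶠ j in atTop, x ∈ s j} := by
  have hset : {x | ∃ᶠ j in atTop, x ∈ s j} = ⋂ n : ℕ, ⋃ j ≥ n, s j := by
    ext x
    simp [frequently_atTop]
  rw [hset]
  refine ge_of_tendsto (tendsto_measure_iInter_atTop (μ := μ)
    (s := fun n : ℕ => ⋃ j ≥ n, s j) (fun n => ?_) ?_ ⟨0, measure_ne_top _ _⟩)
    (Eventually.of_forall fun n => ?_)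
  · exact (MeasurableSet.iUnion fun j => MeasurableSet.iUnion fun _ => hs j).nullMeasurableSet
  · exact fun m n hmn => iUnion₂_mono' fun j hj => ⟨j, hmn.trans hj, subset_rfl⟩
  · exact (hc n).trans (measure_mono (subset_iUnion₂_of_subset n le_rfl subset_rfl))

instance borelSpace_SOG : BorelSpace (SOG d) := ⟨rfl⟩

theorem isClosed_inf_map_ne_bot (L M : Submodule ℝ (Euc d)) :
    IsClosed {g : SOG d | L ⊓ M.map (rotLin g) ≠ ⊥} := by
  let K : Set (Euc d) := Metric.sphere 0 1 ∩ M
  have hK : IsCompact K := (isCompact_sphere 0 1).inter_right M.closed_of_finiteDimensional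
  have : CompactSpace K := isCompact_iff_compactSpace.1 hK
  have hcl : IsClosed {p : SOG d × K | rotLin p.1 p.2 ∈ L} :=
    L.closed_of_finiteDimensional.preimage
      (continuous_rotLin.comp (continuous_fst.prodMk (continuous_subtype_val.comp continuous_snd)))
  convert isClosedMap_fst_of_compactSpace _ hcl
  ext g
  rw [mem_ofPred_eq, Submodule.ne_bot_iff]
  constructor
  · rintro ⟨_, ⟨hL, x, hx, rfl⟩, hne⟩
    have hx0 : x ≠ 0 := by rintro rfl; simp at hne
    refine ⟨(g, ⟨‖x‖⁻¹ • x, ?_, M.smul_mem _ hx⟩), ?_, rfl⟩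
    · simp [norm_smul, hx0]
    · simpa using L.smul_mem _ hL
  · rintro ⟨⟨g, x, hx1, hx⟩, hL, rfl⟩
    refine ⟨rotLin g x, ⟨hL, x, hx, rfl⟩, fun h0 => ?_⟩
    have : x = 0 := by rw [← rotLin_inv_apply g x, h0, map_zero]
    simp [this] at hx1

/-- A subspace and a random rotation of another one almost surely meet only in the origin if their
dimensions add up to at most `d`. -/
theorem ae_inf_map_eq_bot (ν : Measure (SOG d)) [ν.IsMulLeftInvariant] [IsFiniteMeasure ν]
    (M L : Submodule ℝ (Euc d)) (hLM : finrank ℝ L + finrank ℝ M ≤ d) :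
    ∀ᵐ g ∂ν, L ⊓ M.map (rotLin g) = ⊥ := by
  induction L using WellFoundedLT.induction with
  | ind L ih =>
  by_cases hL : L = ⊥
  · simp [hL]
  obtain ⟨e, heL, he0⟩ := L.ne_bot_iff.1 hL
  set L' : Submodule ℝ (Euc d) := L ⊓ (ℝ ∙ e)ᗮ with hL'
  have hlt : L' < L := by
    refine lt_of_le_of_ne inf_le_left fun h => he0 ?_
    have : e ∈ L' := h ▸ heL
    exact inner_self_eq_zero.1 (mem_orthogonal_singleton_iff_inner_right.1 this.2)
  have hrank : finrank ℝ L' < finrank ℝ L := finrank_lt_finrank_of_lt hlt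
  have he : e ∈ L'ᗮ := by
    refine (mem_orthogonal _ _).2 fun x hx => ?_
    exact mem_orthogonal_singleton_iff_inner_left.1 hx.2
  have hdecomp : ∀ x ∈ L, ∃ y ∈ L', ∃ c : ℝ, x = y + c • e := by
    intro x hx
    obtain ⟨y, hy, z, hz, rfl⟩ := (ℝ ∙ e).exists_add_mem_mem_orthogonal x
    obtain ⟨c, rfl⟩ := mem_span_singleton.1 hy
    refine ⟨z, ⟨?_, hz⟩, c, add_comm _ _⟩
    simpa using L.sub_mem hx (L.smul_mem c heL)
  obtain ⟨v, hv⟩ := exists_seq_finite_mem_submodule L'ᗮ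
  choose h hfix hspan using fun j => exists_rotLin_fix L' (v j).2 he he0
  have hB := (isClosed_inf_map_ne_bot L M).measurableSet
  set B : Set (SOG d) := {g | L ⊓ M.map (rotLin g) ≠ ⊥} with hBdef
  have key : ∀ g : SOG d, L' ⊓ M.map (rotLin g) = ⊥ → {j | (h j)⁻¹ * g ∈ B}.Finite := by
    intro g hg
    set W : Submodule ℝ (Euc d) := L' ⊔ M.map (rotLin g) with hW
    have hWtop : W ≠ ⊤ := by
      intro hWt
      have h1 := finrank_add_le_finrank_add_finrank L' (M.map (rotLin g))
      have h2 := finrank_map_le (rotLin g) M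
      rw [← hW, hWt, finrank_top, finrank_euclideanSpace_fin] at h1
      omega
    have hWtop' : W.comap L'ᗮ.subtype ≠ ⊤ := by
      intro h0
      have h1 : L'ᗮ ≤ W := comap_subtype_eq_top.1 h0
      exact hWtop (top_le_iff.1 (L'.sup_orthogonal_of_hasOrthogonalProjection ▸
        sup_le le_sup_left h1))
    refine (hv _ hWtop').subset fun j hj => ?_
    obtain ⟨_, ⟨hxL, m, hm, rfl⟩, hx0⟩ := (Submodule.ne_bot_iff _).1 hj
    obtain ⟨y, hy, c, hyc⟩ := hdecomp _ hxL
    have hgm : rotLin g m = y + c • rotLin (h j) e := by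
      rw [← hfix j y hy, ← map_smul, ← map_add, ← hyc, rotLin_mul, LinearMap.comp_apply,
        rotLin_apply_inv]
    have hc : c ≠ 0 := by
      rintro rfl
      have : rotLin g m ∈ L' ⊓ M.map (rotLin g) :=
        ⟨by rw [hgm]; simpa using hy, m, hm, rfl⟩
      rw [hg, Submodule.mem_bot] at this
      rw [rotLin_mul, LinearMap.comp_apply, this, map_zero] at hx0
      exact hx0 rfl
    have heW : rotLin (h j) e ∈ W := by
      have h1 : c • rotLin (h j) e ∈ W := by
        rw [show c • rotLin (h j) e = rotLin g m - y by rw [hgm]; abel]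
        exact W.sub_mem (le_sup_right (a := L') ⟨m, hm, rfl⟩) (le_sup_left (a := L') hy)
      exact (W.smul_mem_iff hc).1 h1
    exact (span_singleton_le_iff_mem _ _).2 heW (hspan j)
  have hle : ν B ≤ ν {g | ∃ᶠ j in atTop, g ∈ (fun g => (h j)⁻¹ * g) ⁻¹' B} :=
    le_measure_frequently ν (fun j => measurable_const_mul _ hB)
      fun j => (measure_preimage_mul ν _ B).ge
  have hzero : ν {g | ∃ᶠ j in atTop, g ∈ (fun g => (h j)⁻¹ * g) ⁻¹' B} = 0 := by
    refine measure_mono_null (fun g hg => ?_) (ih L' hlt (by omega))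
    exact fun hg' => Nat.frequently_atTop_iff_infinite.1 hg (key g hg')
  exact nonpos_iff_eq_zero.1 (hle.trans hzero.le)

/-- A subspace and a random rotation of another one are almost surely in general position. -/
theorem ae_inf_map_eq_bot_or_sup_eq_top (ν : Measure (SOG d)) [ν.IsMulLeftInvariant]
    [IsFiniteMeasure ν] (L M : Submodule ℝ (Euc d)) :
    ∀ᵐ g ∂ν, L ⊓ M.map (rotLin g) = ⊥ ∨ L ⊔ M.map (rotLin g) = ⊤ := by
  have hMd : finrank ℝ M ≤ d := by simpa using M.finrank_le
  rcases le_total (finrank ℝ L + finrank ℝ M) d with hle | hge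
  · exact (ae_inf_map_eq_bot ν M L hle).mono fun g hg => Or.inl hg
  obtain ⟨v, hv⟩ := exists_linearIndependent_of_le_finrank
    (R := ℝ) (M := L) (n := d - finrank ℝ M) (by omega)
  set L' : Submodule ℝ (Euc d) := (span ℝ (range v)).map L.subtype with hL'
  have hrank : finrank ℝ L' = d - finrank ℝ M := by
    rw [hL', finrank_map_subtype_eq, finrank_span_eq_card hv, Fintype.card_fin]
  filter_upwards [ae_inf_map_eq_bot ν M L' (by omega)] with g hg
  right
  have hle : L' ⊔ M.map (rotLin g) ≤ L ⊔ M.map (rotLin g) :=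
    sup_le_sup_right (map_subtype_le L _) _
  refine top_le_iff.1 (hle.trans' (top_le_iff.2 ?_))
  apply eq_top_of_finrank_eq
  have h1 := finrank_sup_add_finrank_inf_eq L' (M.map (rotLin g))
  have h2 := (equivMapOfInjective (rotLin g)
    (Function.LeftInverse.injective (rotLin_inv_apply g)) M).finrank_eq
  rw [hg, finrank_bot] at h1
  rw [finrank_euclideanSpace_fin]
  omega

theorem IsPolyCone.smul_mem {C : Set (Euc d)} (hC : IsPolyCone C) {x : Euc d} (hx : x ∈ C) {t : ℝ}
    (ht : 0 ≤ t) : t • x ∈ C := by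
  obtain ⟨U, rfl⟩ := hC
  simp only [mem_iInter₂, mem_ofPred_eq, inner_smul_right] at hx ⊢
  exact fun u hu => mul_nonpos_of_nonneg_of_nonpos ht (hx u hu)

theorem IsPolyCone.add_mem {C : Set (Euc d)} (hC : IsPolyCone C) {x y : Euc d} (hx : x ∈ C)
    (hy : y ∈ C) : x + y ∈ C := by
  obtain ⟨U, rfl⟩ := hC
  simp only [mem_iInter₂, mem_ofPred_eq, inner_add_right] at hx hy ⊢
  exact fun u hu => add_nonpos (hx u hu) (hy u hu)

theorem IsPolyCone.zero_mem {C : Set (Euc d)} (hC : IsPolyCone C) : (0 : Euc d) ∈ C := by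
  obtain ⟨U, rfl⟩ := hC
  simp

theorem IsPolyCone.image_rot {D : Set (Euc d)} (hD : IsPolyCone D) (g : SOG d) :
    IsPolyCone (rot g '' D) := by
  classical
  obtain ⟨V, rfl⟩ := hD
  refine ⟨V.image (LinearMap.adjoint (rotLin g⁻¹)), ?_⟩
  have : rot g '' (⋂ u ∈ V, {x | ⟪u, x⟫ ≤ 0}) = rot g⁻¹ ⁻¹' (⋂ u ∈ V, {x | ⟪u, x⟫ ≤ 0}) :=
    congrFun (image_eq_preimage_of_inverse (rotLin_inv_apply g) (rotLin_apply_inv g)) _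
  rw [this]
  ext x
  simp [LinearMap.adjoint_inner_left, rot]

/-- Around each of its points, a polyhedral cone contains a neighbourhood within a subspace through
this point that is taken from a fixed finite family, namely the linear hull of a face. -/
theorem IsPolyCone.exists_finite_submodule {C : Set (Euc d)} (hC : IsPolyCone C) :
    ∃ S : Set (Submodule ℝ (Euc d)), S.Finite ∧ ∀ x ∈ C, ∃ L ∈ S, x ∈ L ∧
      ∀ f ∈ L, ∀ᶠ t in 𝓝 (0 : ℝ), x + t • f ∈ C := by
  classical
  obtain ⟨U, rfl⟩ := hC
  refine ⟨(fun A : Finset (Euc d) => (span ℝ (A : Set (Euc d)))ᗮ) '' U.powerset,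
    U.powerset.finite_toSet.image _, fun x hx => ?_⟩
  have hmem : ∀ A : Finset (Euc d), ∀ f, f ∈ (span ℝ (A : Set (Euc d)))ᗮ ↔ ∀ u ∈ A, ⟪u, f⟫ = 0 := by
    intro A f
    refine ⟨fun h u hu => (mem_orthogonal _ _).1 h u (subset_span hu), fun h => ?_⟩
    rw [← span_singleton_le_iff_mem, ← isOrtho_iff_le, isOrtho_comm, isOrtho_span]
    rintro u hu _ rfl
    exact h u hu
  refine ⟨_, mem_image_of_mem _ (Finset.mem_coe.2 (Finset.mem_powerset.2
    (Finset.filter_subset (fun u => ⟪u, x⟫ = 0) U))), (hmem _ _).2 (by simp), fun f hf => ?_⟩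
  rw [hmem] at hf
  simp only [mem_iInter₂, mem_ofPred_eq] at hx ⊢
  refine (Filter.eventually_all_finset U).2 fun u hu => ?_
  rcases (hx u hu).eq_or_lt with h | h
  · refine Eventually.of_forall fun t => ?_
    rw [inner_add_right, inner_smul_right, h, hf u (by simp [hu, h])]
    simp
  · have hcont : Continuous fun t : ℝ => ⟪u, x + t • f⟫ := by fun_prop
    have h0 : ⟪u, x + (0 : ℝ) • f⟫ < 0 := by simpa using h
    exact (hcont.continuousAt.eventually (gt_mem_nhds h0)).mono fun t ht => ht.le

theorem mem_affineSpan_of_mem_span {C : Set (Euc d)} (h0 : (0 : Euc d) ∈ C) {x : Euc d}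
    (hx : x ∈ span ℝ C) : x ∈ affineSpan ℝ C := by
  rwa [← SetLike.mem_coe, ← affineSpan_insert_zero, insert_eq_of_mem h0] at hx

theorem eventually_add_smul_mem_of_mem_intrinsicInterior {C : Set (Euc d)} (h0 : (0 : Euc d) ∈ C)
    {x y : Euc d} (hx : x ∈ intrinsicInterior ℝ C) (hy : y ∈ span ℝ C) :
    ∀ᶠ t in 𝓝 (0 : ℝ), x + t • y ∈ C := by
  obtain ⟨z, hz, rfl⟩ := mem_intrinsicInterior.1 hx
  have hzs : (z : Euc d) ∈ span ℝ C := affineSpan_subset_span z.2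
  let p : ℝ → affineSpan ℝ C := fun t => ⟨z + t • y, mem_affineSpan_of_mem_span h0
    ((span ℝ C).add_mem hzs ((span ℝ C).smul_mem _ hy))⟩
  have hp : Continuous p := by
    refine Continuous.subtype_mk ?_ _
    fun_prop
  have hp0 : p 0 = z := Subtype.ext (by simp [p])
  have := hp.continuousAt.preimage_mem_nhds (x := 0) (t := (↑) ⁻¹' C)
    (by rw [hp0]; exact mem_interior_iff_mem_nhds.1 hz)
  exact this

/-- A polyhedral cone has a relatively interior direction. -/
theorem IsPolyCone.exists_intrinsicInterior {C : Set (Euc d)} (hC : IsPolyCone C) :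
    ∃ c ∈ C, ∀ y ∈ C, ∀ t : ℝ, 0 < t → y + t • c ∈ intrinsicInterior ℝ C := by
  classical
  have hC' := hC
  obtain ⟨U, hU⟩ := hC
  have hle : ∀ u ∈ U, ∀ x ∈ C, ⟪u, x⟫ ≤ 0 := by
    intro u hu x hx
    rw [hU, mem_iInter₂] at hx
    exact hx u hu
  have hex : ∀ u : Euc d, ∃ c ∈ C, (∃ x ∈ C, ⟪u, x⟫ < 0) → ⟪u, c⟫ < 0 := by
    intro u
    by_cases h : ∃ x ∈ C, ⟪u, x⟫ < 0
    · obtain ⟨x, hx, hux⟩ := h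
      exact ⟨x, hx, fun _ => hux⟩
    · exact ⟨0, hC'.zero_mem, fun h' => absurd h' h⟩
  choose c hcC hc using hex
  have hsum : ∀ V : Finset (Euc d), ∑ v ∈ V, c v ∈ C := fun V =>
    Finset.sum_induction _ (· ∈ C) (fun _ _ => hC'.add_mem) hC'.zero_mem fun v _ => hcC v
  refine ⟨∑ v ∈ U, c v, hsum U, fun y hy t ht => ?_⟩
  have hzC : y + t • ∑ v ∈ U, c v ∈ C := hC'.add_mem hy (hC'.smul_mem (hsum U) ht.le)
  refine mem_intrinsicInterior.2 ⟨⟨_, subset_affineSpan ℝ C hzC⟩, ?_, rfl⟩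
  rw [mem_interior_iff_mem_nhds]
  have hnhds : ∀ᶠ p : affineSpan ℝ C in 𝓝 ⟨_, subset_affineSpan ℝ C hzC⟩,
      ∀ u ∈ U, (∃ x ∈ C, ⟪u, x⟫ < 0) → ⟪u, (p : Euc d)⟫ < 0 := by
    refine (Filter.eventually_all_finset U).2 fun u hu => ?_
    by_cases h : ∃ x ∈ C, ⟪u, x⟫ < 0
    · have hcont : Continuous fun p : affineSpan ℝ C => ⟪u, (p : Euc d)⟫ := by fun_prop
      refine (hcont.continuousAt.eventually (gt_mem_nhds ?_)).mono fun p hp _ => hp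
      have h1 : ⟪u, ∑ v ∈ U, c v⟫ < 0 := by
        rw [← Finset.add_sum_erase U c hu, inner_add_right]
        exact add_neg_of_neg_of_nonpos (hc u h) (hle u hu _ (hsum _))
      change ⟪u, y + t • ∑ v ∈ U, c v⟫ < 0
      rw [inner_add_right, inner_smul_right]
      exact add_neg_of_nonpos_of_neg (hle u hu y hy) (mul_neg_of_pos_of_neg ht h1)
    · exact Eventually.of_forall fun _ h' => absurd h' h
  filter_upwards [hnhds] with p hp
  refine (Set.ext_iff.1 hU _).2 (mem_iInter₂.2 ?_)
  intro u hu
  by_cases h : ∃ x ∈ C, ⟪u, x⟫ < 0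
  · exact (hp u hu h).le
  · have hker : span ℝ C ≤ LinearMap.ker (innerₛₗ ℝ u) := by
      refine span_le.2 fun x hx => ?_
      push Not at h
      exact le_antisymm (hle u hu x hx) (h x hx)
    exact (hker (affineSpan_subset_span p.2)).le

theorem IsPolyCone.isLinSubspace {C : Set (Euc d)} (hC : IsPolyCone C)
    (h : ∀ x ∈ C, -x ∈ C) : IsLinSubspace C := by
  refine ⟨{ carrier := C, add_mem' := hC.add_mem, zero_mem' := hC.zero_mem, smul_mem' := ?_ }, rfl⟩
  intro t x hx
  rcases le_total 0 t with ht | ht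
  · exact hC.smul_mem hx ht
  · simpa using h _ (hC.smul_mem hx (neg_nonneg.2 ht))

theorem IsPolyCone.isLinSubspace_of_neg_mem {C : Set (Euc d)} (hC : IsPolyCone C) {x : Euc d}
    (hx : x ∈ intrinsicInterior ℝ C) (hnx : -x ∈ C) : IsLinSubspace C := by
  refine hC.isLinSubspace fun y hy => ?_
  obtain ⟨t, ht0, htC⟩ := (eventually_add_smul_mem_of_mem_intrinsicInterior hC.zero_mem hx
    ((span ℝ C).neg_mem (subset_span hy))).exists_gt
  have := hC.smul_mem (hC.add_mem hnx htC) (inv_nonneg.2 ht0.le)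
  rwa [neg_add_cancel_left, smul_smul, inv_mul_cancel₀ ht0.ne', one_smul] at this

/-- If the linear hulls of the faces through a common point span the whole space, then the cones
intersect transversely. -/
theorem IsPolyCone.transverse {C D : Set (Euc d)} (hC : IsPolyCone C) (hD : IsPolyCone D)
    {L M : Submodule ℝ (Euc d)} (hLM : L ⊔ M = ⊤) {x : Euc d}
    (hL : ∀ f ∈ L, ∀ᶠ t in 𝓝 (0 : ℝ), x + t • f ∈ C)
    (hM : ∀ f ∈ M, ∀ᶠ t in 𝓝 (0 : ℝ), x + t • f ∈ D) : Transverse C D := by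
  have hle : ∀ {E : Set (Euc d)} {N : Submodule ℝ (Euc d)},
      (∀ f ∈ N, ∀ᶠ t in 𝓝 (0 : ℝ), x + t • f ∈ E) → N ≤ span ℝ E := by
    intro E N h f hf
    have hx : x ∈ E := by simpa using (h 0 N.zero_mem).self_of_nhds
    obtain ⟨t, ht0, htE⟩ := (h f hf).exists_gt
    have := (span ℝ E).sub_mem (subset_span htE) (subset_span hx)
    rw [add_sub_cancel_left] at this
    exact ((span ℝ E).smul_mem_iff ht0.ne').1 this
  obtain ⟨c, -, hc⟩ := hC.exists_intrinsicInterior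
  obtain ⟨e, -, he⟩ := hD.exists_intrinsicInterior
  have htop : c - e ∈ L ⊔ M := hLM ▸ mem_top
  obtain ⟨f, hf, g, hg, hfg⟩ := Submodule.mem_sup.1 htop
  obtain ⟨t, ht, htC, htD⟩ := ((hL _ (L.neg_mem hf)).and (hM g hg)).exists_gt
  have hzC := hc _ htC t ht
  have hzD := he _ htD t ht
  have heq : x + t • g + t • e = x + t • -f + t • c := by
    rw [add_assoc, add_assoc, ← smul_add, ← smul_add,
      show c = f + g + e by rw [hfg, sub_add_cancel]]
    congr 2
    abel
  rw [heq] at hzD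
  set z := x + t • -f + t • c
  refine ⟨?_, z, hzC, hzD⟩
  have hspan : span ℝ (C ∩ D) = span ℝ C ⊓ span ℝ D := by
    refine le_antisymm (le_inf (span_mono inter_subset_left) (span_mono inter_subset_right)) ?_
    rintro y ⟨hyC, hyD⟩
    have hzC' := intrinsicInterior_subset hzC
    have hzD' := intrinsicInterior_subset hzD
    obtain ⟨s, hs0, hsC, hsD⟩ :=
      ((eventually_add_smul_mem_of_mem_intrinsicInterior hC.zero_mem hzC hyC).and
        (eventually_add_smul_mem_of_mem_intrinsicInterior hD.zero_mem hzD hyD)).exists_gt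
    have := (span ℝ (C ∩ D)).sub_mem (subset_span ⟨hsC, hsD⟩) (subset_span ⟨hzC', hzD'⟩)
    rw [add_sub_cancel_left] at this
    exact ((span ℝ (C ∩ D)).smul_mem_iff hs0.ne').1 this
  have hsup : span ℝ C ⊔ span ℝ D = ⊤ := top_le_iff.1 (hLM ▸ sup_le_sup (hle hL) (hle hM))
  have hrank := finrank_sup_add_finrank_inf_eq (span ℝ C) (span ℝ D)
  rw [hsup, finrank_top, finrank_euclideanSpace_fin] at hrank
  unfold dimS linHull
  rw [hspan]
  omega

theorem ae_inter_eq_zero_or_transverse {C D : Set (Euc d)} (hC : IsPolyCone C) (hD : IsPolyCone D)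
    (ν : Measure (SOG d)) [ν.IsMulLeftInvariant] [IsFiniteMeasure ν] :
    ∀ᵐ g ∂ν, C ∩ rot g '' D = {0} ∨ Transverse C (rot g '' D) := by
  obtain ⟨S, hS, hSC⟩ := hC.exists_finite_submodule
  obtain ⟨T, hT, hTD⟩ := hD.exists_finite_submodule
  have hae : ∀ᵐ g ∂ν, ∀ L ∈ S, ∀ M ∈ T, L ⊓ M.map (rotLin g) = ⊥ ∨ L ⊔ M.map (rotLin g) = ⊤ :=
    (ae_ball_iff hS.countable).2 fun L _ => (ae_ball_iff hT.countable).2 fun M _ =>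
      ae_inf_map_eq_bot_or_sup_eq_top ν L M
  filter_upwards [hae] with g hg
  have hgD := hD.image_rot g
  refine or_iff_not_imp_left.2 fun hne => ?_
  obtain ⟨x, ⟨hxC, y, hyD, hyx⟩, hx0⟩ : ∃ x ∈ C ∩ rot g '' D, x ≠ 0 := by
    by_contra! h
    exact hne (Subset.antisymm h (singleton_subset_iff.2 ⟨hC.zero_mem, hgD.zero_mem⟩))
  obtain ⟨L, hLS, hxL, hL⟩ := hSC x hxC
  obtain ⟨M, hMT, hyM, hM⟩ := hTD y hyD
  refine hC.transverse hgD ((hg L hLS M hMT).resolve_left fun hbot => hx0 ?_) hL ?_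
  · exact (Submodule.mem_bot ℝ).1 (hbot ▸ ⟨hxL, y, hyM, hyx⟩)
  · rintro _ ⟨f, hf, rfl⟩
    filter_upwards [hM f hf] with t ht
    refine ⟨_, ht, ?_⟩
    rw [← hyx]
    simp [rot]

theorem IsLinSubspace.of_image_rot {D : Set (Euc d)} {g : SOG d}
    (h : IsLinSubspace (rot g '' D)) : IsLinSubspace D := by
  obtain ⟨L, hL⟩ := h
  refine ⟨L.comap (rotLin g), ?_⟩
  rw [comap_coe, hL]
  exact preimage_image_eq D (Function.LeftInverse.injective (rotLin_inv_apply g))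

/-- Transverse polyhedral cones whose intersection is a subspace are themselves subspaces. -/
theorem Transverse.isLinSubspace {C D : Set (Euc d)} (h : Transverse C D) (hC : IsPolyCone C)
    (hD : IsPolyCone D) (hCD : IsLinSubspace (C ∩ D)) : IsLinSubspace C ∧ IsLinSubspace D := by
  obtain ⟨-, x, hxC, hxD⟩ := h
  obtain ⟨L, hL⟩ := hCD
  have hx : x ∈ L := by
    rw [← SetLike.mem_coe, hL]
    exact ⟨intrinsicInterior_subset hxC, intrinsicInterior_subset hxD⟩
  have hnx : -x ∈ C ∩ D := hL ▸ L.neg_mem hx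
  exact ⟨hC.isLinSubspace_of_neg_mem hxC hnx.1, hD.isLinSubspace_of_neg_mem hxD hnx.2⟩

end

/-- **Lemma 3.3.** For polyhedral cones `C, D ⊆ ℝ^d`, for `ν`-almost all `ϑ ∈ SO(d)` either
`C ∩ ϑD = {o}` or `C ⋔ ϑD`; and, if `C, D` are not both linear subspaces, for `ν`-almost all
`ϑ` either `C ∩ ϑD = {o}` or `C ∩ ϑD` is not a linear subspace. -/
theorem generic_intersection_transverse {d : ℕ} (C D : Set (Euc d))
    (hC : IsPolyCone C) (hD : IsPolyCone D)
    (ν : Measure (SOG d)) [ν.IsHaarMeasure] [IsProbabilityMeasure ν] :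
    ν {ϑ : SOG d | C ∩ rot ϑ '' D = {0} ∨ Transverse C (rot ϑ '' D)} = 1 ∧
    (¬ (IsLinSubspace C ∧ IsLinSubspace D) →
      ν {ϑ : SOG d | C ∩ rot ϑ '' D = {0} ∨ ¬ IsLinSubspace (C ∩ rot ϑ '' D)} = 1) := by
  have h := ae_inter_eq_zero_or_transverse hC hD ν
  have hone : ∀ {p : SOG d → Prop}, (∀ᵐ ϑ ∂ν, p ϑ) → ν {ϑ | p ϑ} = 1 := fun hp =>
    (measure_congr (Filter.eventuallyEq_univ.2 hp)).trans measure_univ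
  refine ⟨hone h, fun hlin => hone (h.mono fun ϑ hϑ => hϑ.imp_right fun ht hsub => hlin ?_)⟩
  exact (ht.isLinSubspace hC (hD.image_rot ϑ) hsub).imp_right IsLinSubspace.of_image_rot
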